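/- Hardy's inequality is strict: for 1 < p < n and every nonzero u ∈ C_c^∞(ℝ^n), ((n-p)/p)^p ∫_{ℝ^n} |u|^p/|x|^p dx < ∫_{ℝ^n} |∇u|^p dx. -/

import Mathlib

open MeasureTheory Set

section PointwiseInequality

lemma young_rpow_lt {p a b : ℝ} (hp : 1 < p) (ha : 0 < a) (hb : 0 ≤ b) (hab : b ≠ a) :
    p * a ^ (p - 1) * b < b ^ p + (p - 1) * a ^ p := by
  have h := one_add_mul_self_lt_rpow_one_add (s := b / a - 1)
    (by linarith [div_nonneg hb ha.le])
    (fun h => hab (by rw [sub_eq_zero, div_eq_one_iff_eq ha.ne'] at h; exact h)) hp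
  rw [add_sub_cancel, Real.div_rpow hb ha.le, lt_div_iff₀ (by positivity)] at h
  have h2 : a ^ p = a ^ (p - 1) * a := by
    rw [← Real.rpow_add_one ha.ne', sub_add_cancel]
  have h3 : (1 + p * (b / a - 1)) * a ^ p = p * a ^ (p - 1) * b - (p - 1) * a ^ p := by
    rw [h2]; field_simp; ring
  linarith

/-- The defect in Hardy's inequality at a point where `u` has value `v`, the gradient of `u` has
norm `b`, and the derivative of `u` in the direction of the position vector, of norm `e`, is `w`. -/
noncomputable def hardyDefect (p γ v w b e : ℝ) : ℝ :=
  b ^ p + (p - 1) * γ ^ p * (|v| ^ p / e ^ p) + p * γ ^ (p - 1) * (|v| ^ (p - 2) * v * w / e ^ p)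

lemma hardyDefect_neg (p γ v w b e : ℝ) :
    hardyDefect p γ (-v) (-w) b e = hardyDefect p γ v w b e := by
  simp [hardyDefect]

lemma hardyDefect_of_pos {p γ v w b e : ℝ} (hγ : 0 < γ) (he : 0 < e) (hv : 0 < v) :
    hardyDefect p γ v w b e =
      b ^ p + (p - 1) * (γ * v / e) ^ p + p * (γ * v / e) ^ (p - 1) * (w / e) := by
  have h1 : e ^ p = e ^ (p - 1) * e := by rw [← Real.rpow_add_one he.ne', sub_add_cancel]
  have h2 : v ^ (p - 1) = v ^ (p - 2) * v := by
    rw [← Real.rpow_add_one hv.ne']; congr 1; ring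
  have h3 : (γ * v / e) ^ p = γ ^ p * v ^ p / e ^ p := by
    rw [Real.div_rpow (by positivity) he.le, Real.mul_rpow hγ.le hv.le]
  have h4 : (γ * v / e) ^ (p - 1) = γ ^ (p - 1) * v ^ (p - 1) / e ^ (p - 1) := by
    rw [Real.div_rpow (by positivity) he.le, Real.mul_rpow hγ.le hv.le]
  rw [hardyDefect, abs_of_pos hv, h3, h4, h2, h1]
  field_simp

lemma hardyDefect_nonneg_and_eq_zero_of_pos {p γ v w b e : ℝ} (hp : 1 < p) (hγ : 0 < γ)
    (he : 0 < e) (hb : 0 ≤ b) (hw : |w| ≤ b * e) (hv : 0 < v) :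
    0 ≤ hardyDefect p γ v w b e ∧ (hardyDefect p γ v w b e = 0 → w + γ * v = 0) := by
  rw [hardyDefect_of_pos hγ he hv]
  have ha : 0 < γ * v / e := by positivity
  have hwe : -b ≤ w / e := by
    rw [le_div_iff₀ he]
    linarith [neg_abs_le w]
  have hmul : p * (γ * v / e) ^ (p - 1) * -b ≤ p * (γ * v / e) ^ (p - 1) * (w / e) :=
    mul_le_mul_of_nonneg_left hwe (by positivity)
  by_cases hab : b = γ * v / e
  · have h2 : (γ * v / e) ^ p = (γ * v / e) ^ (p - 1) * (γ * v / e) := by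
      rw [← Real.rpow_add_one ha.ne', sub_add_cancel]
    have h3 : b ^ p + (p - 1) * (γ * v / e) ^ p + p * (γ * v / e) ^ (p - 1) * (w / e)
        = p * (γ * v / e) ^ (p - 1) * (γ * v / e + w / e) := by
      rw [hab, h2]; ring
    rw [h3]
    have hpos : 0 < p * (γ * v / e) ^ (p - 1) := by positivity
    refine ⟨mul_nonneg hpos.le (by linarith), fun h => ?_⟩
    have h4 := (mul_eq_zero.mp h).resolve_left hpos.ne'
    rw [← add_div, div_eq_zero_iff] at h4
    linarith [h4.resolve_right he.ne']
  · have h := young_rpow_lt hp ha hb hab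
    exact ⟨by linarith, fun h' => by linarith⟩

lemma hardyDefect_nonneg_and_eq_zero {p γ v w b e : ℝ} (hp : 1 < p) (hγ : 0 < γ) (he : 0 < e)
    (hb : 0 ≤ b) (hw : |w| ≤ b * e) :
    0 ≤ hardyDefect p γ v w b e ∧ (hardyDefect p γ v w b e = 0 → w + γ * v = 0) := by
  rcases lt_trichotomy v 0 with hv | rfl | hv
  · have h := hardyDefect_nonneg_and_eq_zero_of_pos (v := -v) (w := -w) hp hγ he hb
      (by rwa [abs_neg]) (by linarith)
    rw [hardyDefect_neg] at h
    exact ⟨h.1, fun h0 => by linarith [h.2 h0]⟩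
  · have h : hardyDefect p γ 0 w b e = b ^ p := by
      simp [hardyDefect, Real.zero_rpow (by linarith : p ≠ 0)]
    rw [h]
    refine ⟨by positivity, fun h0 => ?_⟩
    rw [Real.rpow_eq_zero hb (by linarith)] at h0
    rw [h0, zero_mul] at hw
    simpa using hw
  · exact hardyDefect_nonneg_and_eq_zero_of_pos hp hγ he hb hw hv

end PointwiseInequality

section Scaling

variable {E : Type*} [NormedAddCommGroup E] [NormedSpace ℝ E]

/-- A compactly supported solution of Euler's equation for functions homogeneous of degree `-γ`
vanishes. -/
lemma eq_zero_of_fderiv_apply_self_add_eq_zero {u : E → ℝ} (hu : Differentiable ℝ u)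
    (hsupp : HasCompactSupport u) {γ : ℝ} (hγ : γ ≠ 0)
    (h : ∀ x, fderiv ℝ u x x + γ * u x = 0) : u = 0 := by
  funext x
  rcases eq_or_ne x 0 with rfl | hx
  · simpa [hγ] using h 0
  have hder : ∀ s : ℝ, HasDerivAt
      (fun s : ℝ => Real.exp (γ * s) * u (Real.exp s • x)) 0 s := by
    intro s
    have h1 : HasDerivAt (fun s : ℝ => Real.exp (γ * s)) (Real.exp (γ * s) * γ) s := by
      simpa using ((hasDerivAt_id s).const_mul γ).exp
    have h2 : HasDerivAt (fun s : ℝ => u (Real.exp s • x))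
        (fderiv ℝ u (Real.exp s • x) (Real.exp s • x)) s :=
      (hu _).hasFDerivAt.comp_hasDerivAt s ((Real.hasDerivAt_exp s).smul_const x)
    refine (h1.mul h2).congr_deriv ?_
    linear_combination Real.exp (γ * s) * h (Real.exp s • x)
  have hconst := fun s => is_const_of_deriv_eq_zero (fun s => (hder s).differentiableAt)
    (fun s => (hder s).deriv) 0 s
  obtain ⟨R, hR0, hR⟩ := hsupp.isBounded.exists_pos_norm_lt
  have hs : u (Real.exp (Real.log (R / ‖x‖)) • x) = 0 := by
    by_contra hne
    have h1 := hR _ (subset_tsupport u hne)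
    rw [Real.exp_log (by positivity), norm_smul, Real.norm_of_nonneg (by positivity),
      div_mul_cancel₀ _ (norm_ne_zero_iff.mpr hx)] at h1
    exact lt_irrefl _ h1
  have h2 := hconst (Real.log (R / ‖x‖))
  rw [hs] at h2
  simpa using h2

variable [FiniteDimensional ℝ E] [MeasurableSpace E] [BorelSpace E]
  {μ : Measure E} [μ.IsAddHaarMeasure]

open Metric Module

lemma integrable_of_norm_le_rpow_of_eq_zero {f : E → ℝ} {C α r : ℝ} (hd : 1 ≤ finrank ℝ E)
    (hα : α < finrank ℝ E) (hf : AEStronglyMeasurable f μ)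
    (hle : ∀ x ∈ ball (0 : E) r, ‖f x‖ ≤ C * ‖x‖ ^ (-α)) (hzero : ∀ x ∉ ball (0 : E) r, f x = 0) :
    Integrable f μ :=
  IntegrableOn.integrable_of_forall_notMem_eq_zero
    (integrableOn_ball_of_norm_le_rpow hd hα
      ((ae_restrict_iff' measurableSet_ball).mpr (ae_of_all _ hle)) hf) hzero

lemma abs_rpow_sub_two_mul_self (p v : ℝ) (hp : 1 < p) :
    |(|v| ^ (p - 2) * v)| = |v| ^ (p - 1) := by
  rcases eq_or_ne v 0 with rfl | hv
  · simp [Real.zero_rpow (by linarith : p - 1 ≠ 0)]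
  · rw [abs_mul, abs_of_nonneg (by positivity), ← Real.rpow_add_one (abs_pos.mpr hv).ne']
    congr 1; ring

lemma integrable_abs_rpow_div_norm_rpow {p : ℝ} (hp : 1 < p) (hpd : p < finrank ℝ E) {u : E → ℝ}
    (hu : Continuous u) (hsupp : HasCompactSupport u) :
    Integrable (fun x => |u x| ^ p / ‖x‖ ^ p) μ := by
  obtain ⟨M, hM⟩ := hu.bounded_above_of_compact_support hsupp
  obtain ⟨R, hR0, hR⟩ := hsupp.isBounded.exists_pos_norm_lt
  have hd : 1 ≤ finrank ℝ E := by
    have : (1 : ℝ) < finrank ℝ E := hp.trans hpd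
    exact_mod_cast this.le
  refine integrable_of_norm_le_rpow_of_eq_zero (r := R) (C := M ^ p) hd hpd ?_ ?_ ?_
  · have := hu.measurable
    exact Measurable.aestronglyMeasurable (by fun_prop)
  · intro x _
    rw [Real.norm_of_nonneg (by positivity), Real.rpow_neg (norm_nonneg _), div_eq_mul_inv]
    gcongr
    exact hM x
  · intro x hx
    have : u x = 0 := by
      by_contra hne
      exact hx (by simpa using hR _ (subset_tsupport u hne))
    simp [this, Real.zero_rpow (by linarith : p ≠ 0)]

lemma integral_scaled_abs_rpow_div_norm_rpow (p : ℝ) (u : E → ℝ) {t : ℝ} (ht : 0 < t) :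
    ∫ x, |u (t • x)| ^ p / ‖x‖ ^ p ∂μ
      = t ^ (p - finrank ℝ E) * ∫ x, |u x| ^ p / ‖x‖ ^ p ∂μ := by
  have h1 : ∀ x : E, |u (t • x)| ^ p / ‖x‖ ^ p
      = t ^ p * (|u (t • x)| ^ p / ‖t • x‖ ^ p) := by
    intro x
    rw [norm_smul, Real.norm_of_nonneg ht.le, Real.mul_rpow ht.le (norm_nonneg _)]
    have : t ^ p ≠ 0 := (Real.rpow_pos_of_pos ht p).ne'
    rw [← mul_div_assoc, mul_div_mul_left _ _ this]
  simp_rw [h1]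
  rw [integral_const_mul,
    Measure.integral_comp_smul_of_nonneg μ (fun x => |u x| ^ p / ‖x‖ ^ p) t (hR := ht.le),
    Real.rpow_sub ht, Real.rpow_natCast, smul_eq_mul]
  ring

/-- Integration by parts against `x / ‖x‖ ^ p`, obtained by differentiating the scaling
`t ↦ ∫ |u (t x)| ^ p / ‖x‖ ^ p` at `t = 1`. -/
lemma integral_radial_deriv {p : ℝ} (hp : 1 < p) (hpd : p < finrank ℝ E) {u : E → ℝ}
    (hu : ContDiff ℝ 1 u) (hsupp : HasCompactSupport u) :
    Integrable (fun x => |u x| ^ (p - 2) * u x * fderiv ℝ u x x / ‖x‖ ^ p) μ ∧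
    p * ∫ x, |u x| ^ (p - 2) * u x * fderiv ℝ u x x / ‖x‖ ^ p ∂μ
      = (p - finrank ℝ E) * ∫ x, |u x| ^ p / ‖x‖ ^ p ∂μ := by
  have hd : 1 ≤ finrank ℝ E := by
    have : (1 : ℝ) < finrank ℝ E := hp.trans hpd
    exact_mod_cast this.le
  have huc := hu.continuous
  have hdu : Continuous (fderiv ℝ u) := hu.continuous_fderiv one_ne_zero
  obtain ⟨M, hM⟩ := huc.bounded_above_of_compact_support hsupp
  obtain ⟨N, hN⟩ := hdu.bounded_above_of_compact_support (hsupp.fderiv ℝ)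
  obtain ⟨R, hR0, hR⟩ := hsupp.isBounded.exists_pos_norm_lt
  have hM0 : 0 ≤ M := (norm_nonneg _).trans (hM 0)
  have hN0 : 0 ≤ N := (norm_nonneg _).trans (hN 0)
  have hmeas := huc.measurable
  have hmeas' : Measurable fun x => fderiv ℝ u x x := (hdu.clm_apply continuous_id).measurable
  have hbound : ∀ x : E, ∀ t ∈ ball (1 : ℝ) (1 / 2),
      ‖p * |u (t • x)| ^ (p - 2) * u (t • x) * fderiv ℝ u (t • x) x / ‖x‖ ^ p‖
        ≤ (ball (0 : E) (2 * R)).indicator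
          (fun x => p * M ^ (p - 1) * (N * (2 * R)) * ‖x‖ ^ (-p)) x := by
    intro x t ht
    by_cases hx : x ∈ ball (0 : E) (2 * R)
    · rw [indicator_of_mem hx]
      rw [mem_ball_zero_iff] at hx
      have hfd : |fderiv ℝ u (t • x) x| ≤ N * (2 * R) :=
        ((fderiv ℝ u (t • x)).le_opNorm x).trans (by gcongr; exact hN _)
      rw [Real.norm_eq_abs, abs_div, abs_mul, mul_assoc p, abs_mul, abs_of_pos (by linarith : 0 < p),
        abs_rpow_sub_two_mul_self p _ hp, abs_of_nonneg (by positivity : 0 ≤ ‖x‖ ^ p),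
        Real.rpow_neg (norm_nonneg _), div_eq_mul_inv]
      gcongr
      exact hM _
    · rw [indicator_of_notMem hx]
      have : u (t • x) = 0 := by
        by_contra hne
        have h1 := hR _ (subset_tsupport u hne)
        rw [mem_ball_zero_iff, not_lt] at hx
        rw [mem_ball, Real.dist_eq, abs_lt] at ht
        rw [norm_smul, Real.norm_of_nonneg (by linarith)] at h1
        nlinarith
      simp [this]
  have hbint : Integrable ((ball (0 : E) (2 * R)).indicator
      (fun x => p * M ^ (p - 1) * (N * (2 * R)) * ‖x‖ ^ (-p))) μ := by
    refine integrable_of_norm_le_rpow_of_eq_zero (r := 2 * R)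
      (C := p * M ^ (p - 1) * (N * (2 * R))) hd hpd ?_ ?_ ?_
    · exact (Measurable.indicator (by fun_prop) measurableSet_ball).aestronglyMeasurable
    · intro x hx
      rw [indicator_of_mem hx, Real.norm_of_nonneg (by positivity)]
    · intro x hx
      exact indicator_of_notMem hx _
  have hdiff : ∀ x : E, ∀ t ∈ ball (1 : ℝ) (1 / 2), HasDerivAt
      (fun t : ℝ => |u (t • x)| ^ p / ‖x‖ ^ p)
      (p * |u (t • x)| ^ (p - 2) * u (t • x) * fderiv ℝ u (t • x) x / ‖x‖ ^ p) t := by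
    intro x t _
    have h1 : HasDerivAt (fun t : ℝ => u (t • x)) (fderiv ℝ u (t • x) x) t := by
      have h2 : HasDerivAt (fun t : ℝ => t • x) x t := by
        simpa using (hasDerivAt_id t).smul_const x
      exact ((hu.differentiable one_ne_zero) _).hasFDerivAt.comp_hasDerivAt t h2
    exact ((hasDerivAt_abs_rpow (u (t • x)) hp).comp t h1).div_const _
  have hkey := hasDerivAt_integral_of_dominated_loc_of_deriv_le (μ := μ)
    (F := fun (t : ℝ) (x : E) => |u (t • x)| ^ p / ‖x‖ ^ p)
    (F' := fun (t : ℝ) (x : E) =>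
      p * |u (t • x)| ^ (p - 2) * u (t • x) * fderiv ℝ u (t • x) x / ‖x‖ ^ p)
    (x₀ := (1 : ℝ)) (ball_mem_nhds 1 (by norm_num : (0 : ℝ) < 1 / 2))
    (Filter.Eventually.of_forall fun t => Measurable.aestronglyMeasurable (by fun_prop))
    (by simpa using integrable_abs_rpow_div_norm_rpow hp hpd huc hsupp)
    (by
      simp only [one_smul]
      exact Measurable.aestronglyMeasurable (by fun_prop))
    (ae_of_all _ hbound) hbint (ae_of_all _ hdiff)
  have hscale : HasDerivAt (fun t : ℝ => ∫ x, |u (t • x)| ^ p / ‖x‖ ^ p ∂μ)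
      ((p - finrank ℝ E) * ∫ x, |u x| ^ p / ‖x‖ ^ p ∂μ) 1 := by
    have h1 := ((Real.hasDerivAt_rpow_const (x := 1) (p := p - finrank ℝ E)
      (Or.inl one_ne_zero)).mul_const (∫ x, |u x| ^ p / ‖x‖ ^ p ∂μ))
    rw [Real.one_rpow, mul_one] at h1
    refine h1.congr_of_eventuallyEq ?_
    filter_upwards [lt_mem_nhds one_pos] with t ht
    exact integral_scaled_abs_rpow_div_norm_rpow p u ht
  have hmul : ∀ x, p * |u x| ^ (p - 2) * u x * fderiv ℝ u x x / ‖x‖ ^ p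
      = p * (|u x| ^ (p - 2) * u x * fderiv ℝ u x x / ‖x‖ ^ p) := fun x => by ring
  simp only [one_smul, hmul] at hkey
  refine ⟨?_, ?_⟩
  · exact (integrable_const_mul_iff (by simpa using (by linarith : p ≠ 0)) _).mp hkey.1
  · rw [← integral_const_mul]
    exact hkey.2.unique hscale

end Scaling

/-- Hardy's inequality is strict: for `1 < p < n` and every nonzero
`u ∈ C_c^∞(ℝ^n)`, `((n-p)/p)^p ∫ |u|^p/|x|^p dx < ∫ |∇u|^p dx`. -/
theorem hardy_strict {n : ℕ} (p : ℝ) (hp : 1 < p) (hpn : p < n)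
    (u : EuclideanSpace ℝ (Fin n) → ℝ) (hu : ContDiff ℝ (⊤ : ℕ∞) u)
    (hsupp : HasCompactSupport u) (hne : u ≠ 0) :
    (((n:ℝ) - p) / p) ^ p * ∫ x : EuclideanSpace ℝ (Fin n), |u x| ^ p / ‖x‖ ^ p
      < ∫ x : EuclideanSpace ℝ (Fin n), ‖fderiv ℝ u x‖ ^ p := by
  have hp0 : 0 < p := by linarith
  have hu1 : ContDiff ℝ 1 u := hu.of_le (by exact_mod_cast le_top)
  have hdu : Continuous (fderiv ℝ u) := hu1.continuous_fderiv one_ne_zero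
  have hfin : Module.finrank ℝ (EuclideanSpace ℝ (Fin n)) = n := by simp
  have : Nontrivial (EuclideanSpace ℝ (Fin n)) := by
    apply Module.nontrivial_of_finrank_pos (R := ℝ)
    rw [hfin]
    exact_mod_cast hp0.trans hpn
  obtain ⟨γ, hγ⟩ : ∃ γ, γ = ((n : ℝ) - p) / p := ⟨_, rfl⟩
  have hγ0 : 0 < γ := by rw [hγ]; exact div_pos (by linarith) hp0
  have hA : Integrable (fun x : EuclideanSpace ℝ (Fin n) => |u x| ^ p / ‖x‖ ^ p) :=
    integrable_abs_rpow_div_norm_rpow hp (by rwa [hfin]) hu1.continuous hsupp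
  obtain ⟨hG, hGA⟩ := integral_radial_deriv (μ := volume) hp (by rwa [hfin]) hu1 hsupp
  rw [hfin] at hGA
  have hB : Integrable (fun x : EuclideanSpace ℝ (Fin n) => ‖fderiv ℝ u x‖ ^ p) := by
    refine (hdu.norm.rpow_const fun _ => Or.inr hp0.le).integrable_of_hasCompactSupport ?_
    exact (hsupp.fderiv ℝ).comp_left (g := fun L => ‖L‖ ^ p) (by simp [Real.zero_rpow hp0.ne'])
  rw [← hγ]
  have hBA : Integrable fun x : EuclideanSpace ℝ (Fin n) =>
      ‖fderiv ℝ u x‖ ^ p + (p - 1) * γ ^ p * (|u x| ^ p / ‖x‖ ^ p) :=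
    hB.add (hA.const_mul _)
  have hint : Integrable fun x => hardyDefect p γ (u x) (fderiv ℝ u x x) ‖fderiv ℝ u x‖ ‖x‖ :=
    hBA.add (hG.const_mul _)
  have hval : ∫ x, hardyDefect p γ (u x) (fderiv ℝ u x x) ‖fderiv ℝ u x‖ ‖x‖
      = (∫ x, ‖fderiv ℝ u x‖ ^ p) - γ ^ p * ∫ x, |u x| ^ p / ‖x‖ ^ p := by
    simp only [hardyDefect]
    rw [integral_add hBA (hG.const_mul _), integral_add hB (hA.const_mul _),
      integral_const_mul, integral_const_mul]
    have h1 : γ ^ p = γ ^ (p - 1) * γ := by rw [← Real.rpow_add_one hγ0.ne', sub_add_cancel]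
    have h2 : (p - n) = - (p * γ) := by rw [hγ]; field_simp; ring
    rw [h2] at hGA
    rw [h1]
    linear_combination γ ^ (p - 1) * hGA
  have hpt : ∀ᵐ x : EuclideanSpace ℝ (Fin n),
      0 ≤ hardyDefect p γ (u x) (fderiv ℝ u x x) ‖fderiv ℝ u x‖ ‖x‖ ∧
      (hardyDefect p γ (u x) (fderiv ℝ u x x) ‖fderiv ℝ u x‖ ‖x‖ = 0 →
        fderiv ℝ u x x + γ * u x = 0) := by
    filter_upwards [Measure.ae_ne volume 0] with x hx
    exact hardyDefect_nonneg_and_eq_zero hp hγ0 (norm_pos_iff.mpr hx) (norm_nonneg _)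
      ((fderiv ℝ u x).le_opNorm x)
  have hnn : 0 ≤ᵐ[volume] fun x => hardyDefect p γ (u x) (fderiv ℝ u x x) ‖fderiv ℝ u x‖ ‖x‖ :=
    hpt.mono fun _ h => h.1
  rw [← sub_pos, ← hval]
  refine (integral_nonneg_of_ae hnn).lt_of_ne fun h0 => hne ?_
  have hae := (integral_eq_zero_iff_of_nonneg_ae hnn hint).mp h0.symm
  have hzero : (fun x => fderiv ℝ u x x + γ * u x) =ᵐ[volume] fun _ => 0 := by
    filter_upwards [hpt, hae] with x hx hx0 using hx.2 hx0
  have hcont : Continuous fun x => fderiv ℝ u x x + γ * u x :=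
    (hdu.clm_apply continuous_id).add (continuous_const.mul hu1.continuous)
  exact eq_zero_of_fderiv_apply_self_add_eq_zero (hu1.differentiable one_ne_zero) hsupp hγ0.ne'
    (congrFun ((hcont.ae_eq_iff_eq volume continuous_const).mp hzero))
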